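/- Let N be the number of triangulations of P. Then Σ_T x(T), the sum over all triangulations T of P, equals (N·(n+2)/2)·(1,1,…,1); equivalently, for every j ∈ [n+1], 2·Σ_T x_j(T) = N·(n+2). In particular, the barycenter of the points x(T) is the point ((n+2)/2, …, (n+2)/2), which is the barycenter of the vertices of the permutahedron conv{(σ(1),…,σ(n+1)) : σ a permutation of [n+1]}. -/

import Mathlib

attribute [local instance] Classical.propDecidable

noncomputable section

namespace Spines

/-- Position of vertex `v ∈ {0,…,n+2}` in the counterclockwise boundary cyclic order:
`0`, then the elements of `D` in increasing order, then `n+2`, then the elements of `U`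
in decreasing order. -/
def pos (n : ℕ) (D U : Finset ℕ) (v : ℕ) : ℕ :=
  if v = 0 then 0
  else if v = n + 2 then D.card + 1
  else if v ∈ D then 1 + (D.filter (fun d => d < v)).card
  else D.card + 2 + (U.filter (fun u => v < u)).card

/-- Cyclic distance from `a` to `v` in counterclockwise direction. -/
def relpos (n : ℕ) (D U : Finset ℕ) (a v : ℕ) : ℕ :=
  (pos n D U v + (n + 3) - pos n D U a) % (n + 3)

/-- `v` lies strictly inside the counterclockwise boundary arc from `a` to `b`. -/
def StrictBetween (n : ℕ) (D U : Finset ℕ) (a b v : ℕ) : Prop :=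
  v ≤ n + 2 ∧ 0 < relpos n D U a v ∧ relpos n D U a v < relpos n D U a b

/-- A diagonal, encoded as an ordered pair `(a,b)` with `a < b ≤ n+2`. -/
def IsDiag (n : ℕ) (δ : ℕ × ℕ) : Prop := δ.1 < δ.2 ∧ δ.2 ≤ n + 2

/-- A boundary edge: the endpoints are adjacent in the cyclic order. -/
def IsBoundaryEdge (n : ℕ) (D U : Finset ℕ) (δ : ℕ × ℕ) : Prop :=
  IsDiag n δ ∧ (relpos n D U δ.1 δ.2 = 1 ∨ relpos n D U δ.2 δ.1 = 1)

/-- An internal diagonal. -/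
def IsInternalDiag (n : ℕ) (D U : Finset ℕ) (δ : ℕ × ℕ) : Prop :=
  IsDiag n δ ∧ ¬ IsBoundaryEdge n D U δ

/-- Two diagonals cross: the four endpoints are pairwise distinct and exactly one
endpoint of the second lies strictly inside each of the two arcs determined by the first. -/
def Cross (n : ℕ) (D U : Finset ℕ) (δ δ' : ℕ × ℕ) : Prop :=
  δ.1 ≠ δ.2 ∧ δ'.1 ≠ δ'.2 ∧ δ.1 ≠ δ'.1 ∧ δ.1 ≠ δ'.2 ∧ δ.2 ≠ δ'.1 ∧ δ.2 ≠ δ'.2 ∧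
  ((StrictBetween n D U δ.1 δ.2 δ'.1 ∧ StrictBetween n D U δ.2 δ.1 δ'.2) ∨
   (StrictBetween n D U δ.1 δ.2 δ'.2 ∧ StrictBetween n D U δ.2 δ.1 δ'.1))

/-- A triangulation: a maximal set of pairwise non-crossing internal diagonals. -/
def IsTriangulation (n : ℕ) (D U : Finset ℕ) (T : Finset (ℕ × ℕ)) : Prop :=
  (∀ δ ∈ T, IsInternalDiag n D U δ) ∧
  (∀ δ ∈ T, ∀ δ' ∈ T, ¬ Cross n D U δ δ') ∧
  (∀ δ, IsInternalDiag n D U δ → δ ∉ T → ∃ δ' ∈ T, Cross n D U δ δ')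

/-- `a` and `b` (with `a < b`) are joined by a diagonal of `T` or a boundary edge. -/
def EdgeOf (n : ℕ) (D U : Finset ℕ) (T : Finset (ℕ × ℕ)) (a b : ℕ) : Prop :=
  (a, b) ∈ T ∨ IsBoundaryEdge n D U (a, b)

/-- `{i,j,k}` with `i<j<k` is a triangle of the triangulation `T`. -/
def IsTriangleOf (n : ℕ) (D U : Finset ℕ) (T : Finset (ℕ × ℕ)) (i j k : ℕ) : Prop :=
  i < j ∧ j < k ∧ k ≤ n + 2 ∧
    EdgeOf n D U T i j ∧ EdgeOf n D U T j k ∧ EdgeOf n D U T i k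

/-- `Bel δ`: labels in `[n+1]` strictly inside the ccw arc from `δ.1` to `δ.2`,
together with the endpoints of `δ` lying in `U`. -/
def Bel (n : ℕ) (D U : Finset ℕ) (δ : ℕ × ℕ) : Finset ℕ :=
  (Finset.Icc 1 (n + 1)).filter
    (fun j => StrictBetween n D U δ.1 δ.2 j ∨ (j ∈ U ∧ (j = δ.1 ∨ j = δ.2)))

def bel (n : ℕ) (D U : Finset ℕ) (δ : ℕ × ℕ) : ℕ := (Bel n D U δ).card

def Abo (n : ℕ) (D U : Finset ℕ) (δ : ℕ × ℕ) : Finset ℕ :=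
  Finset.Icc 1 (n + 1) \ Bel n D U δ

/-- The coordinates of the point `x(T)` associated to a triangulation `T`. -/
def xcoord (n : ℕ) (D U : Finset ℕ) (T : Finset (ℕ × ℕ)) (j : ℕ) : ℝ :=
  if h : ∃ p : ℕ × ℕ, IsTriangleOf n D U T p.1 j p.2 then
    if j ∈ D then
      ((bel n D U (h.choose.1, j) : ℝ) + 1) * ((bel n D U (j, h.choose.2) : ℝ) + 1)
    else
      ((n : ℝ) + 2) -
        (((n : ℝ) + 2) - (bel n D U (h.choose.1, j) : ℝ)) *
          (((n : ℝ) + 2) - (bel n D U (j, h.choose.2) : ℝ))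
  else 0

/-- Middle vertex of the triple `{a,b,c}` with `a < b` and `c ∉ {a,b}`. -/
def midOf (a b c : ℕ) : ℕ := if c < a then a else if c < b then c else b

/-- `c` is the third vertex of a triangle of `T` containing the diagonal `δ`. -/
def TriWith (n : ℕ) (D U : Finset ℕ) (T : Finset (ℕ × ℕ)) (δ : ℕ × ℕ) (c : ℕ) : Prop :=
  if c < δ.1 then IsTriangleOf n D U T c δ.1 δ.2
  else if c < δ.2 then IsTriangleOf n D U T δ.1 c δ.2
  else IsTriangleOf n D U T δ.1 δ.2 c

/-- `s_δ`: middle vertex of the triangle of `T` below `δ` (third vertex strictly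
inside the ccw arc from `δ.1` to `δ.2`). -/
def spineSrc (n : ℕ) (D U : Finset ℕ) (T : Finset (ℕ × ℕ)) (δ : ℕ × ℕ) : ℕ :=
  if h : ∃ c, StrictBetween n D U δ.1 δ.2 c ∧ TriWith n D U T δ c then
    midOf δ.1 δ.2 h.choose
  else 0

/-- `t_δ`: middle vertex of the triangle of `T` above `δ` (third vertex strictly
inside the ccw arc from `δ.2` to `δ.1`). -/
def spineTgt (n : ℕ) (D U : Finset ℕ) (T : Finset (ℕ × ℕ)) (δ : ℕ × ℕ) : ℕ :=
  if h : ∃ c, StrictBetween n D U δ.2 δ.1 c ∧ TriWith n D U T δ c then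
    midOf δ.1 δ.2 h.choose
  else 0

/-- `(p,q)` is an arc of the spine of `T`. -/
def SpineArc (n : ℕ) (D U : Finset ℕ) (T : Finset (ℕ × ℕ)) (p q : ℕ) : Prop :=
  ∃ δ ∈ T, spineSrc n D U T δ = p ∧ spineTgt n D U T δ = q

/-- The finite set of all triangulations of the polygon. -/
def allTri (n : ℕ) (D U : Finset ℕ) : Finset (Finset (ℕ × ℕ)) :=
  ((Finset.range (n + 3) ×ˢ Finset.range (n + 3)).filter
      (fun δ => IsInternalDiag n D U δ)).powerset.filter
    (fun T => IsTriangulation n D U T)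

end Spines

namespace Spines

/-- The inclusion-maximal subsets of `P` whose elements are pairwise unrelated by `X`. -/
def maxIndep {α : Type*} (P : Finset α) (X : α → α → Prop) : Finset (Finset α) :=
  P.powerset.filter fun T => ∀ e, e ∈ T ↔ e ∈ P ∧ ∀ f ∈ T, ¬ X e f

theorem mem_maxIndep {α : Type*} {P : Finset α} {X : α → α → Prop} {T : Finset α} :
    T ∈ maxIndep P X ↔ ∀ e, e ∈ T ↔ e ∈ P ∧ ∀ f ∈ T, ¬ X e f := by
  simp only [maxIndep, Finset.mem_filter, Finset.mem_powerset, and_iff_right_iff_imp]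
  exact fun h e he => ((h e).1 he).1

theorem subset_of_mem_maxIndep {α : Type*} {P : Finset α} {X : α → α → Prop} {T : Finset α}
    (hT : T ∈ maxIndep P X) : T ⊆ P := fun e he => ((mem_maxIndep.1 hT e).1 he).1

theorem image_mem_maxIndep_iff {α β : Type*} [DecidableEq β]
    {P : Finset α} {X : α → α → Prop} {Y : β → β → Prop}
    {φ : α → β} (hφ : Set.InjOn φ P) (hX : ∀ e ∈ P, ∀ f ∈ P, (X e f ↔ Y (φ e) (φ f)))
    {T : Finset α} (hT : T ⊆ P) :
    T.image φ ∈ maxIndep (P.image φ) Y ↔ T ∈ maxIndep P X := by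
  rw [mem_maxIndep, mem_maxIndep]
  have hmem : ∀ e ∈ P, (φ e ∈ T.image φ ↔ e ∈ T) := by
    intro e he
    rw [Finset.mem_image]
    exact ⟨fun ⟨f, hf, hfe⟩ => hφ (hT hf) he hfe ▸ hf, fun h => ⟨e, h, rfl⟩⟩
  have hfree : ∀ e ∈ P, ((∀ f ∈ T.image φ, ¬ Y (φ e) f) ↔ ∀ f ∈ T, ¬ X e f) := by
    intro e he
    rw [Finset.forall_mem_image]
    exact forall₂_congr fun f hf => not_congr (hX e he f (hT hf)).symm
  constructor
  · intro h e
    by_cases he : e ∈ P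
    · rw [← hmem e he, h, hfree e he]
      simp [he, Finset.mem_image_of_mem φ he]
    · exact ⟨fun h' => absurd (hT h') he, fun h' => absurd h'.1 he⟩
  · intro h e
    by_cases he : e ∈ P.image φ
    · obtain ⟨e, he', rfl⟩ := Finset.mem_image.1 he
      rw [hmem e he', h, hfree e he']
      simp [he, he']
    · exact ⟨fun h' => absurd (Finset.image_subset_image hT h') he, fun h' => absurd h'.1 he⟩

/-- Maximal independent sets are transported by isomorphisms of graphs. -/
theorem sum_maxIndep_image {α β : Type*} {M : Type*} [AddCommMonoid M] [DecidableEq β]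
    {P : Finset α} {X : α → α → Prop} {Y : β → β → Prop}
    (φ : α → β) (hφ : Set.InjOn φ P) (hX : ∀ e ∈ P, ∀ f ∈ P, (X e f ↔ Y (φ e) (φ f)))
    (w : Finset β → M) :
    ∑ T ∈ maxIndep P X, w (T.image φ) = ∑ T ∈ maxIndep (P.image φ) Y, w T := by
  refine Finset.sum_bij (fun T _ => T.image φ) ?_ ?_ ?_ ?_
  · exact fun T hT => (image_mem_maxIndep_iff hφ hX (subset_of_mem_maxIndep hT)).2 hT
  · intro T hT S hS h
    have h' : φ '' (T : Set α) = φ '' S := by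
      exact_mod_cast congrArg (fun s : Finset β => (s : Set β)) h
    exact_mod_cast (hφ.image_eq_image_iff (subset_of_mem_maxIndep hT)
      (subset_of_mem_maxIndep hS)).1 h'
  · intro S hS
    have hSP := subset_of_mem_maxIndep hS
    obtain ⟨T, hT, rfl⟩ := Finset.subset_image_iff.1 hSP
    exact ⟨T, (image_mem_maxIndep_iff hφ hX hT).1 hS, rfl⟩
  · exact fun _ _ => rfl

/-- Two chords of a convex polygon, with vertices on a line, cross. -/
def LinCross (e f : ℕ × ℕ) : Prop :=
  (e.1 < f.1 ∧ f.1 < e.2 ∧ e.2 < f.2) ∨ (f.1 < e.1 ∧ e.1 < f.2 ∧ f.2 < e.2)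

/-- The increasing pairs of elements of `V`. -/
def chords (V : Finset ℕ) : Finset (ℕ × ℕ) := (V ×ˢ V).filter fun e => e.1 < e.2

theorem mem_chords {V : Finset ℕ} {e : ℕ × ℕ} :
    e ∈ chords V ↔ e.1 ∈ V ∧ e.2 ∈ V ∧ e.1 < e.2 := by
  simp [chords, and_assoc]

/-- Triangulations, boundary edges included, of the convex polygon with vertex set `V`. -/
def fullTri (V : Finset ℕ) : Finset (Finset (ℕ × ℕ)) := maxIndep (chords V) LinCross

theorem mem_fullTri {V : Finset ℕ} {T : Finset (ℕ × ℕ)} :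
    T ∈ fullTri V ↔
      ∀ e : ℕ × ℕ, e ∈ T ↔ (e.1 ∈ V ∧ e.2 ∈ V ∧ e.1 < e.2) ∧ ∀ f ∈ T, ¬ LinCross e f := by
  simp only [fullTri, mem_maxIndep, mem_chords]

/-- The number of triangulations of a convex polygon with `d + 1` vertices. -/
def triCount (d : ℕ) : ℕ := (fullTri (Finset.range (d + 1))).card

theorem card_fullTri {V : Finset ℕ} {d : ℕ} (hV : V.card = d + 1) :
    (fullTri V).card = triCount d := by
  obtain ⟨f, hf, hV'⟩ : ∃ f : ℕ → ℕ, (∀ i < d + 1, ∀ j < d + 1, (f i < f j ↔ i < j)) ∧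
      ∀ v, v ∈ V ↔ ∃ i < d + 1, f i = v := by
    refine ⟨fun i => if h : i < d + 1 then V.orderEmbOfFin hV ⟨i, h⟩ else 0, ?_, ?_⟩
    · intro i hi j hj
      simp only [dif_pos hi, dif_pos hj, OrderEmbedding.lt_iff_lt, Fin.mk_lt_mk]
    · intro v
      rw [← Finset.mem_coe, ← Finset.range_orderEmbOfFin V hV]
      constructor
      · rintro ⟨i, rfl⟩
        exact ⟨i, i.2, dif_pos i.2⟩
      · rintro ⟨i, hi, rfl⟩
        exact ⟨⟨i, hi⟩, by simp only [dif_pos hi]⟩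
  have hinj : ∀ i < d + 1, ∀ j < d + 1, f i = f j → i = j := by
    intro i hi j hj h
    have h1 := hf i hi j hj
    have h2 := hf j hj i hi
    omega
  have himg : chords V = (chords (Finset.range (d + 1))).image (fun e => (f e.1, f e.2)) := by
    ext ⟨a, b⟩
    simp only [mem_chords, Finset.mem_image, Finset.mem_range, Prod.mk.injEq, Prod.exists, hV']
    constructor
    · rintro ⟨⟨i, hi, rfl⟩, ⟨j, hj, rfl⟩, h⟩
      exact ⟨i, j, ⟨hi, hj, (hf i hi j hj).1 h⟩, rfl, rfl⟩
    · rintro ⟨i, j, ⟨hi, hj, h⟩, rfl, rfl⟩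
      exact ⟨⟨i, hi, rfl⟩, ⟨j, hj, rfl⟩, (hf i hi j hj).2 h⟩
  have hsum := sum_maxIndep_image (P := chords (Finset.range (d + 1))) (X := LinCross)
    (Y := LinCross) (fun e => (f e.1, f e.2)) ?_ ?_ (fun _ => 1)
  · rw [← himg, ← Finset.card_eq_sum_ones, ← Finset.card_eq_sum_ones] at hsum
    exact hsum.symm
  · rintro ⟨a, b⟩ ha ⟨c, e⟩ hc h
    simp only [Finset.mem_coe, mem_chords, Finset.mem_range, Prod.mk.injEq] at ha hc h ⊢
    exact ⟨hinj _ ha.1 _ hc.1 h.1, hinj _ ha.2.1 _ hc.2.1 h.2⟩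
  · rintro ⟨a, b⟩ ha ⟨c, e⟩ hc
    simp only [mem_chords, Finset.mem_range] at ha hc
    simp only [LinCross, hf a ha.1 c hc.1, hf c hc.1 b ha.2.1, hf b ha.2.1 e hc.2.1,
      hf c hc.1 a ha.1, hf a ha.1 e hc.2.1, hf e hc.2.1 b ha.2.1]

/-- Cutting along the chord `(a, b)`: a triangulation containing it is a pair of triangulations
of the two sides. -/
theorem card_fullTri_split {V : Finset ℕ} {a b : ℕ} (ha : a ∈ V) (hb : b ∈ V) (hab : a < b)
    {A B : Finset (ℕ × ℕ)} (hA : A ⊆ chords (V.filter fun v => a ≤ v ∧ v ≤ b))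
    (hB : B ⊆ chords (V.filter fun v => v ≤ a ∨ b ≤ v)) :
    ((fullTri V).filter fun T => (a, b) ∈ T ∧ A ⊆ T ∧ B ⊆ T).card =
      ((fullTri (V.filter fun v => a ≤ v ∧ v ≤ b)).filter fun T => A ⊆ T).card *
        ((fullTri (V.filter fun v => v ≤ a ∨ b ≤ v)).filter fun T => B ⊆ T).card := by
  rw [← Finset.card_product]
  refine Finset.card_nbij'
    (fun T => (T.filter (fun e => a ≤ e.1 ∧ e.2 ≤ b),
      T.filter (fun e => (e.1 ≤ a ∨ b ≤ e.1) ∧ (e.2 ≤ a ∨ b ≤ e.2))))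
    (fun p => p.1 ∪ p.2) ?_ ?_ ?_ ?_
  · intro T hT
    simp only [Finset.coe_filter, Set.mem_ofPred_eq, mem_fullTri] at hT
    obtain ⟨hT, habT, hAT, hBT⟩ := hT
    simp only [Finset.coe_product, Set.mem_prod, Finset.coe_filter, Set.mem_ofPred_eq, mem_fullTri,
      Finset.mem_filter]
    refine ⟨⟨?_, ?_⟩, ⟨?_, ?_⟩⟩
    · intro e
      constructor
      · intro he
        have := (hT e).1 he.1
        exact ⟨⟨⟨this.1.1, by omega⟩, ⟨this.1.2.1, by omega⟩, this.1.2.2⟩,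
          fun f hf => this.2 f hf.1⟩
      · rintro ⟨h1, h2⟩
        refine ⟨(hT e).2 ⟨⟨h1.1.1, h1.2.1.1, h1.2.2⟩, fun f hf => ?_⟩, h1.1.2.1, h1.2.1.2.2⟩
        have hf1 := ((hT f).1 hf)
        have hf2 := hf1.2 _ habT
        by_cases hfin : a ≤ f.1 ∧ f.2 ≤ b
        · exact h2 f ⟨hf, hfin⟩
        · simp only [LinCross] at hf2 ⊢
          omega
    · exact fun e he => Finset.mem_filter.2 ⟨hAT he, by
        have := mem_chords.1 (hA he)
        simp only [Finset.mem_filter] at this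
        omega⟩
    · intro e
      constructor
      · intro he
        have := (hT e).1 he.1
        exact ⟨⟨⟨this.1.1, by omega⟩, ⟨this.1.2.1, by omega⟩, this.1.2.2⟩,
          fun f hf => this.2 f hf.1⟩
      · rintro ⟨h1, h2⟩
        refine ⟨(hT e).2 ⟨⟨h1.1.1, h1.2.1.1, h1.2.2⟩, fun f hf => ?_⟩, h1.1.2, h1.2.1.2⟩
        have hf1 := ((hT f).1 hf)
        have hf2 := hf1.2 _ habT
        by_cases hfin : (f.1 ≤ a ∨ b ≤ f.1) ∧ (f.2 ≤ a ∨ b ≤ f.2)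
        · exact h2 f ⟨hf, hfin⟩
        · simp only [LinCross] at hf2 ⊢
          omega
    · exact fun e he => Finset.mem_filter.2 ⟨hBT he, by
        have := mem_chords.1 (hB he)
        simp only [Finset.mem_filter] at this
        omega⟩
  · rintro ⟨S, R⟩ hSR
    simp only [Finset.coe_product, Set.mem_prod, Finset.coe_filter, Set.mem_ofPred_eq, mem_fullTri,
      Finset.mem_filter] at hSR
    obtain ⟨⟨hS, hAS⟩, hR, hBR⟩ := hSR
    have habS : (a, b) ∈ S := by
      refine (hS _).2 ⟨⟨⟨ha, by simp; omega⟩, ⟨hb, by simp; omega⟩, hab⟩, fun f hf => ?_⟩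
      have := ((hS f).1 hf).1
      simp only [LinCross]
      omega
    simp only [Finset.coe_filter, Set.mem_ofPred_eq, mem_fullTri]
    refine ⟨fun e => ?_, Finset.mem_union_left _ habS,
      hAS.trans Finset.subset_union_left, hBR.trans Finset.subset_union_right⟩
    constructor
    · intro he
      rcases Finset.mem_union.1 he with he | he
      · have h := (hS e).1 he
        refine ⟨⟨h.1.1.1, h.1.2.1.1, h.1.2.2⟩, fun f hf => ?_⟩
        rcases Finset.mem_union.1 hf with hf | hf
        · exact h.2 f hf
        · have := ((hR f).1 hf).1
          simp only [LinCross]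
          omega
      · have h := (hR e).1 he
        refine ⟨⟨h.1.1.1, h.1.2.1.1, h.1.2.2⟩, fun f hf => ?_⟩
        rcases Finset.mem_union.1 hf with hf | hf
        · have := ((hS f).1 hf).1
          simp only [LinCross]
          omega
        · exact h.2 f hf
    · rintro ⟨h1, h2⟩
      have h3 := h2 _ (Finset.mem_union_left _ habS)
      simp only [LinCross] at h3
      by_cases hin : a ≤ e.1 ∧ e.2 ≤ b
      · refine Finset.mem_union_left _ ((hS e).2 ⟨⟨⟨h1.1, by omega⟩, ⟨h1.2.1, by omega⟩, h1.2.2⟩,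
          fun f hf => h2 f (Finset.mem_union_left _ hf)⟩)
      · refine Finset.mem_union_right _ ((hR e).2 ⟨⟨⟨h1.1, by omega⟩, ⟨h1.2.1, by omega⟩, h1.2.2⟩,
          fun f hf => h2 f (Finset.mem_union_right _ hf)⟩)
  · intro T hT
    simp only [Finset.coe_filter, Set.mem_ofPred_eq, mem_fullTri] at hT
    obtain ⟨hT, habT, -, -⟩ := hT
    ext e
    simp only [Finset.mem_union, Finset.mem_filter]
    refine ⟨fun h => h.elim And.left And.left, fun he => ?_⟩
    have h1 := (hT e).1 he
    have h2 := h1.2 _ habT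
    simp only [LinCross] at h2
    simp only [he, true_and]
    omega
  · rintro ⟨S, R⟩ hSR
    simp only [Finset.coe_product, Set.mem_prod, Finset.coe_filter, Set.mem_ofPred_eq, mem_fullTri,
      Finset.mem_filter] at hSR
    obtain ⟨⟨hS, -⟩, hR, -⟩ := hSR
    have habS : (a, b) ∈ S := by
      refine (hS _).2 ⟨⟨⟨ha, by simp; omega⟩, ⟨hb, by simp; omega⟩, hab⟩, fun f hf => ?_⟩
      have := ((hS f).1 hf).1
      simp only [LinCross]
      omega
    have habR : (a, b) ∈ R := by
      refine (hR _).2 ⟨⟨⟨ha, by simp⟩, ⟨hb, by simp⟩, hab⟩, fun f hf => ?_⟩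
      have := ((hR f).1 hf).1
      simp only [LinCross]
      omega
    refine Prod.ext (Finset.ext fun e => ?_) (Finset.ext fun e => ?_)
    · simp only [Finset.mem_union, Finset.mem_filter]
      constructor
      · rintro ⟨he | he, h⟩
        · exact he
        · have := ((hR e).1 he).1
          obtain rfl : e = (a, b) := Prod.ext (by simp; omega) (by simp; omega)
          exact habS
      · intro he
        have := ((hS e).1 he).1
        exact ⟨Or.inl he, by omega⟩
    · simp only [Finset.mem_union, Finset.mem_filter]
      constructor
      · rintro ⟨he | he, h⟩
        · have := ((hS e).1 he).1
          obtain rfl : e = (a, b) := Prod.ext (by simp; omega) (by simp; omega)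
          exact habR
        · exact he
      · intro he
        have := ((hR e).1 he).1
        exact ⟨Or.inr he, by omega⟩

theorem triCount_eq_one {d : ℕ} (hd : d ≤ 2) : triCount d = 1 := by
  have h : fullTri (Finset.range (d + 1)) = {chords (Finset.range (d + 1))} := by
    have hno : ∀ e ∈ chords (Finset.range (d + 1)), ∀ f ∈ chords (Finset.range (d + 1)),
        ¬ LinCross e f := by
      intro e he f hf
      simp only [mem_chords, Finset.mem_range] at he hf
      simp only [LinCross]
      omega
    ext T
    rw [fullTri, mem_maxIndep, Finset.mem_singleton]
    constructor
    · intro hT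
      ext e
      exact ⟨fun he => ((hT e).1 he).1,
        fun he => (hT e).2 ⟨he, fun f hf => hno e he f ((hT f).1 hf).1⟩⟩
    · rintro rfl e
      exact ⟨fun he => ⟨he, hno e he⟩, And.left⟩
  rw [triCount, h, Finset.card_singleton]

/-- The triangle with vertices `0`, `a`, `b` belongs to `T`. -/
def RootTriangle (T : Finset (ℕ × ℕ)) (a b : ℕ) : Prop :=
  (0, a) ∈ T ∧ (a, b) ∈ T ∧ (0, b) ∈ T

theorem card_rootTriangle {d a b : ℕ} (ha : 1 ≤ a) (hab : a < b) (hb : b ≤ d) :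
    ((fullTri (Finset.range (d + 1))).filter fun T => RootTriangle T a b).card =
      triCount a * triCount (b - a) * triCount (d + 1 - b) := by
  have h1 := card_fullTri_split (V := Finset.range (d + 1)) (a := 0) (b := b)
    (A := {(0, a), (a, b)}) (B := ∅) (by simp) (by simp; omega) (by omega)
    (by
      intro e he
      simp only [Finset.mem_insert, Finset.mem_singleton] at he
      rw [mem_chords]
      rcases he with rfl | rfl <;> simp <;> omega) (by simp)
  have hV1 : (Finset.range (d + 1)).filter (fun v => 0 ≤ v ∧ v ≤ b) = Finset.range (b + 1) := by
    ext v; simp; omega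
  have hV1' : (Finset.range (d + 1)).filter (fun v => v ≤ 0 ∨ b ≤ v)
      = insert 0 (Finset.Icc b d) := by
    ext v; simp; omega
  have h2 := card_fullTri_split (V := Finset.range (b + 1)) (a := 0) (b := a)
    (A := ∅) (B := {(a, b)}) (by simp) (by simp; omega) (by omega) (by simp)
    (by
      intro e he
      simp only [Finset.mem_singleton] at he
      rw [mem_chords]
      subst he
      simp; omega)
  have hV2 : (Finset.range (b + 1)).filter (fun v => 0 ≤ v ∧ v ≤ a) = Finset.range (a + 1) := by
    ext v; simp; omega
  have hV2' : (Finset.range (b + 1)).filter (fun v => v ≤ 0 ∨ a ≤ v)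
      = insert 0 (Finset.Icc a b) := by
    ext v; simp; omega
  have h3 := card_fullTri_split (V := insert 0 (Finset.Icc a b)) (a := a) (b := b)
    (A := ∅) (B := ∅) (by simp; omega) (by simp; omega) hab (by simp) (by simp)
  have hV3 : (insert 0 (Finset.Icc a b)).filter (fun v => a ≤ v ∧ v ≤ b) = Finset.Icc a b := by
    ext v; simp; omega
  have hV3' : (insert 0 (Finset.Icc a b)).filter (fun v => v ≤ a ∨ b ≤ v) = {0, a, b} := by
    ext v; simp; omega
  have hc1 : (insert 0 (Finset.Icc b d)).card = (d + 1 - b) + 1 := by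
    rw [Finset.card_insert_of_notMem (by simp; omega), Nat.card_Icc]
  have hc3 : (Finset.Icc a b).card = (b - a) + 1 := by rw [Nat.card_Icc]; omega
  have hc3' : ({0, a, b} : Finset ℕ).card = 2 + 1 := by
    rw [Finset.card_eq_three.2 ⟨0, a, b, by omega, by omega, by omega, rfl⟩]
  rw [hV1, hV1'] at h1
  rw [hV2, hV2'] at h2
  rw [hV3, hV3'] at h3
  simp only [Finset.empty_subset, Finset.filter_true, and_true, true_and,
    Finset.insert_subset_iff, Finset.singleton_subset_iff] at h1 h2 h3
  rw [card_fullTri hc1] at h1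
  rw [card_fullTri hc3, card_fullTri hc3', triCount_eq_one le_rfl, mul_one] at h3
  have e1 : ((fullTri (Finset.range (d + 1))).filter fun T => RootTriangle T a b) =
      (fullTri (Finset.range (d + 1))).filter fun T => (0, b) ∈ T ∧ (0, a) ∈ T ∧ (a, b) ∈ T := by
    refine Finset.filter_congr fun T _ => ?_
    rw [RootTriangle]
    tauto
  rw [e1, h1, h2, h3]
  rfl

theorem exists_rootTriangle {d t : ℕ} (ht : 1 ≤ t) (htd : t < d) {T : Finset (ℕ × ℕ)}
    (hT : T ∈ fullTri (Finset.range (d + 1))) :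
    ∃ a ∈ Finset.Icc 1 t, ∃ b ∈ Finset.Icc (t + 1) d, RootTriangle T a b := by
  simp only [mem_fullTri, Finset.mem_range] at hT
  have h1 : (0, 1) ∈ T := (hT _).2 ⟨⟨by simp, by simp; omega, by simp⟩, fun f _ => by
    simp only [LinCross]; omega⟩
  have hd : (0, d) ∈ T := (hT _).2 ⟨⟨by simp, by simp, by simp; omega⟩, fun f hf => by
    have := ((hT f).1 hf).1
    simp only [LinCross]; omega⟩
  have hne : ((Finset.Icc 1 t).filter fun a => (0, a) ∈ T).Nonempty :=
    ⟨1, by simp [h1, ht]⟩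
  have hne' : ((Finset.Icc (t + 1) d).filter fun b => (0, b) ∈ T).Nonempty :=
    ⟨d, by simp [hd]; omega⟩
  obtain ⟨a, ha, hamax⟩ := Finset.exists_max_image _ id hne
  obtain ⟨b, hb, hbmin⟩ := Finset.exists_min_image _ id hne'
  simp only [Finset.mem_filter, Finset.mem_Icc, id] at ha hb hamax hbmin
  refine ⟨a, by simp; omega, b, by simp; omega, ha.2, (hT _).2 ⟨by simp; omega, ?_⟩, hb.2⟩
  rintro ⟨c, e⟩ hce hX
  have hc := (hT _).1 hce
  have ha' := hc.2 _ ha.2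
  have hb' := hc.2 _ hb.2
  have hcd := hc.1
  simp only [LinCross] at hX ha' hb' hcd
  rcases Nat.eq_zero_or_pos c with rfl | hc0
  · by_cases het : e ≤ t
    · have := hamax e ⟨by omega, hce⟩
      omega
    · have := hbmin e ⟨by omega, hce⟩
      omega
  · omega

theorem rootTriangle_unique {d t a b a' b' : ℕ} {T : Finset (ℕ × ℕ)}
    (hT : T ∈ fullTri (Finset.range (d + 1)))
    (ha : a ∈ Finset.Icc 1 t) (hb : b ∈ Finset.Icc (t + 1) d) (h : RootTriangle T a b)
    (ha' : a' ∈ Finset.Icc 1 t) (hb' : b' ∈ Finset.Icc (t + 1) d) (h' : RootTriangle T a' b') :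
    a = a' ∧ b = b' := by
  rw [mem_fullTri] at hT
  simp only [Finset.mem_Icc] at ha hb ha' hb'
  have h1 := ((hT _).1 h.2.1).2 _ h'.1
  have h2 := ((hT _).1 h.2.1).2 _ h'.2.2
  have h3 := ((hT _).1 h'.2.1).2 _ h.1
  have h4 := ((hT _).1 h'.2.1).2 _ h.2.2
  simp only [LinCross] at h1 h2 h3 h4
  omega

/-- The sum of `g a b` over the triangles `0ab` of `T` with `a ≤ t < b ≤ d`. -/
def switchWeight (d t : ℕ) (g : ℕ → ℕ → ℕ) (T : Finset (ℕ × ℕ)) : ℕ :=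
  ∑ a ∈ Finset.Icc 1 t, ∑ b ∈ Finset.Icc (t + 1) d, if RootTriangle T a b then g a b else 0

theorem switchWeight_eq {d t a b : ℕ} (g : ℕ → ℕ → ℕ) {T : Finset (ℕ × ℕ)}
    (hT : T ∈ fullTri (Finset.range (d + 1)))
    (ha : a ∈ Finset.Icc 1 t) (hb : b ∈ Finset.Icc (t + 1) d) (h : RootTriangle T a b) :
    switchWeight d t g T = g a b := by
  rw [switchWeight, Finset.sum_eq_single_of_mem a ha, Finset.sum_eq_single_of_mem b hb, if_pos h]
  · intro b' hb' hne
    exact if_neg fun h' => hne (rootTriangle_unique hT ha hb' h' ha hb h).2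
  · intro a' ha' hne
    refine Finset.sum_eq_zero fun b' hb' => ?_
    exact if_neg fun h' => hne (rootTriangle_unique hT ha' hb' h' ha hb h).1

theorem sum_switchWeight {d t : ℕ} (g : ℕ → ℕ → ℕ) :
    ∑ T ∈ fullTri (Finset.range (d + 1)), switchWeight d t g T =
      ∑ a ∈ Finset.Icc 1 t, ∑ b ∈ Finset.Icc (t + 1) d,
        g a b * (triCount a * triCount (b - a) * triCount (d + 1 - b)) := by
  simp only [switchWeight]
  rw [Finset.sum_comm]
  refine Finset.sum_congr rfl fun a ha => ?_
  rw [Finset.sum_comm]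
  refine Finset.sum_congr rfl fun b hb => ?_
  rw [Finset.mem_Icc] at ha hb
  rw [← Finset.sum_filter, Finset.sum_const, card_rootTriangle ha.1 (by omega) hb.2, smul_eq_mul,
    mul_comm]

theorem triCount_rec {d : ℕ} (hd : 2 ≤ d) :
    triCount d = ∑ a ∈ Finset.Icc 1 (d - 1), triCount a * triCount (d - a) := by
  have h := sum_switchWeight (d := d) (t := d - 1) fun _ _ => 1
  have h1 : ∀ T ∈ fullTri (Finset.range (d + 1)),
      switchWeight d (d - 1) (fun _ _ => 1) T = 1 := by
    intro T hT
    obtain ⟨a, ha, b, hb, hab⟩ := exists_rootTriangle (t := d - 1) (by omega) (by omega) hT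
    exact switchWeight_eq _ hT ha hb hab
  rw [Finset.sum_congr rfl h1, ← Finset.card_eq_sum_ones] at h
  have h2 : d - 1 + 1 = d := by omega
  have h3 : d + 1 - d = 1 := by omega
  rw [← triCount] at h
  simpa [h2, h3, triCount_eq_one] using h

theorem triCount_pos (d : ℕ) : 0 < triCount d := by
  induction d using Nat.strong_induction_on with
  | _ d ih =>
    by_cases hd : d ≤ 2
    · simp [triCount_eq_one hd]
    · rw [triCount_rec (by omega)]
      exact Finset.sum_pos (fun a ha => by
        rw [Finset.mem_Icc] at ha
        exact Nat.mul_pos (ih a (by omega)) (ih _ (by omega))) ⟨1, by simp; omega⟩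

theorem two_mul_sum_mul_triCount {d : ℕ} (hd : 2 ≤ d) :
    2 * ∑ a ∈ Finset.Icc 1 (d - 1), a * triCount a * triCount (d - a) = d * triCount d := by
  have hrefl : ∑ a ∈ Finset.Icc 1 (d - 1), a * triCount a * triCount (d - a) =
      ∑ a ∈ Finset.Icc 1 (d - 1), (d - a) * triCount a * triCount (d - a) := by
    refine Finset.sum_nbij' (fun a => d - a) (fun a => d - a) ?_ ?_ ?_ ?_ ?_
    · intro a ha; rw [Finset.mem_Icc] at *; omega
    · intro a ha; rw [Finset.mem_Icc] at *; omega
    · intro a ha; rw [Finset.mem_Icc] at *; omega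
    · intro a ha; rw [Finset.mem_Icc] at *; omega
    · intro a ha
      rw [Finset.mem_Icc] at ha
      rw [show d - (d - a) = a by omega]
      ring
  rw [two_mul]
  nth_rw 2 [hrefl]
  rw [← Finset.sum_add_distrib, triCount_rec hd, Finset.mul_sum]
  refine Finset.sum_congr rfl fun a ha => ?_
  rw [Finset.mem_Icc] at ha
  rw [mul_assoc, mul_assoc, ← add_mul, Nat.add_sub_cancel' (by omega)]

theorem two_mul_sum_sum_triCount {t s : ℕ} (ht : 1 ≤ t) (hs : 1 ≤ s) :
    2 * ∑ a ∈ Finset.Icc 1 t, ∑ c ∈ Finset.Icc 1 s,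
        a * c * (triCount a * triCount c * triCount (t + s + 1 - a - c)) =
      (t + s) * triCount (t + s) := by
  induction t, ht using Nat.le_induction generalizing s with
  | base =>
    rw [Finset.Icc_self, Finset.sum_singleton, add_comm 1 s,
      ← two_mul_sum_mul_triCount (d := s + 1) (by omega)]
    congr 1
    refine Finset.sum_congr rfl fun c hc => ?_
    rw [triCount_eq_one one_le_two, show s + 1 + 1 - 1 - c = s + 1 - c by omega]
    ring
  | succ t ht ih =>
    have h := ih (s := s + 1) (by omega)
    have h1 := two_mul_sum_mul_triCount (d := s + 1) (by omega)
    have h2 := two_mul_sum_mul_triCount (d := t + 1) (by omega)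
    rw [Nat.add_sub_cancel] at h1 h2
    rw [show t + 1 + s = t + (s + 1) by omega, ← h, Finset.sum_Icc_succ_top (by omega)]
    simp_rw [Finset.sum_Icc_succ_top (show 1 ≤ s + 1 by omega)]
    rw [Finset.sum_add_distrib, mul_add, mul_add]
    congr 1
    have e1 : ∑ c ∈ Finset.Icc 1 s, (t + 1) * c * (triCount (t + 1) * triCount c *
          triCount (t + (s + 1) + 1 - (t + 1) - c)) =
        (t + 1) * triCount (t + 1) *
          ∑ c ∈ Finset.Icc 1 s, c * triCount c * triCount (s + 1 - c) := by
      rw [Finset.mul_sum]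
      refine Finset.sum_congr rfl fun c hc => ?_
      rw [show t + (s + 1) + 1 - (t + 1) - c = s + 1 - c by omega]
      ring
    have e2 : ∑ a ∈ Finset.Icc 1 t, a * (s + 1) * (triCount a * triCount (s + 1) *
          triCount (t + (s + 1) + 1 - a - (s + 1))) =
        (s + 1) * triCount (s + 1) *
          ∑ a ∈ Finset.Icc 1 t, a * triCount a * triCount (t + 1 - a) := by
      rw [Finset.mul_sum]
      refine Finset.sum_congr rfl fun a ha => ?_
      rw [show t + (s + 1) + 1 - a - (s + 1) = t + 1 - a by omega]
      ring
    rw [e1, e2, mul_left_comm, h1, mul_left_comm 2, h2]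
    ring

/-- The average over all triangulations of the product `a * (d + 1 - b)`, where `0ab` is the
triangle at `0` switching sides at `t`, does not depend on `t`. -/
theorem two_mul_sum_switchWeight {d t : ℕ} (ht : 1 ≤ t) (htd : t < d) :
    2 * ∑ T ∈ fullTri (Finset.range (d + 1)), switchWeight d t (fun a b => a * (d + 1 - b)) T =
      d * triCount d := by
  obtain ⟨s, rfl⟩ := Nat.exists_eq_add_of_le htd.le
  rw [sum_switchWeight, ← two_mul_sum_sum_triCount ht (show 1 ≤ s by omega)]
  congr 1
  refine Finset.sum_congr rfl fun a ha => ?_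
  rw [Finset.mem_Icc] at ha
  refine Finset.sum_nbij' (fun b => t + s + 1 - b) (fun c => t + s + 1 - c) ?_ ?_ ?_ ?_ ?_
  · intro b hb; rw [Finset.mem_Icc] at *; omega
  · intro b hb; rw [Finset.mem_Icc] at *; omega
  · intro b hb; rw [Finset.mem_Icc] at *; omega
  · intro b hb; rw [Finset.mem_Icc] at *; omega
  · intro b hb
    rw [Finset.mem_Icc] at hb
    rw [show t + s + 1 - a - (t + s + 1 - b) = b - a by omega]
    ring

variable {n : ℕ} {D U : Finset ℕ}

theorem mem_or_mem_iff (hUD : D ∪ U = Finset.Icc 1 (n + 1)) (v : ℕ) :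
    (v ∈ D ∨ v ∈ U) ↔ 1 ≤ v ∧ v ≤ n + 1 := by
  rw [← Finset.mem_union, hUD, Finset.mem_Icc]

theorem card_add_card (hUD : D ∪ U = Finset.Icc 1 (n + 1)) (hdisj : Disjoint D U) :
    D.card + U.card = n + 1 := by
  rw [← Finset.card_union_of_disjoint hdisj, hUD, Nat.card_Icc, Nat.add_sub_cancel]

theorem pos_zero : pos n D U 0 = 0 := by simp [pos]

theorem pos_top : pos n D U (n + 2) = D.card + 1 := by simp [pos]

theorem pos_of_mem_down (hUD : D ∪ U = Finset.Icc 1 (n + 1)) {v : ℕ} (hv : v ∈ D) :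
    pos n D U v = 1 + (D.filter (fun d => d < v)).card := by
  have h := (mem_or_mem_iff hUD v).1 (Or.inl hv)
  rw [pos, if_neg (by omega), if_neg (by omega), if_pos hv]

theorem pos_of_mem_up (hUD : D ∪ U = Finset.Icc 1 (n + 1)) (hdisj : Disjoint D U) {v : ℕ}
    (hv : v ∈ U) : pos n D U v = D.card + 2 + (U.filter (fun u => v < u)).card := by
  have h := (mem_or_mem_iff hUD v).1 (Or.inr hv)
  rw [pos, if_neg (by omega), if_neg (by omega), if_neg (Finset.disjoint_right.1 hdisj hv)]

theorem card_filter_lt_card {S : Finset ℕ} {p : ℕ → Prop} [DecidablePred p] {v : ℕ} (hv : v ∈ S)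
    (hp : ¬ p v) : (S.filter p).card < S.card :=
  Finset.card_lt_card (Finset.filter_ssubset.2 ⟨v, hv, hp⟩)

theorem eq_zero_or_top_or_mem (hUD : D ∪ U = Finset.Icc 1 (n + 1)) {v : ℕ} (hv : v ≤ n + 2) :
    v = 0 ∨ v = n + 2 ∨ v ∈ D ∨ v ∈ U := by
  have := mem_or_mem_iff hUD v
  by_cases h : v ∈ D ∨ v ∈ U
  · tauto
  · rw [this] at h
    omega

theorem pos_bounds (hUD : D ∪ U = Finset.Icc 1 (n + 1)) (hdisj : Disjoint D U) {v : ℕ} :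
    (v ∈ D → 1 ≤ pos n D U v ∧ pos n D U v ≤ D.card) ∧
      (v ∈ U → D.card + 2 ≤ pos n D U v ∧ pos n D U v ≤ n + 2) := by
  have hc := card_add_card hUD hdisj
  constructor <;> intro hv
  · have := card_filter_lt_card (p := fun d => d < v) hv (lt_irrefl v)
    rw [pos_of_mem_down hUD hv]
    omega
  · have := card_filter_lt_card (p := fun d => v < d) hv (lt_irrefl v)
    rw [pos_of_mem_up hUD hdisj hv]
    omega

theorem pos_le (hUD : D ∪ U = Finset.Icc 1 (n + 1)) (hdisj : Disjoint D U) {v : ℕ}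
    (hv : v ≤ n + 2) : pos n D U v ≤ n + 2 := by
  have hc := card_add_card hUD hdisj
  have hb := pos_bounds hUD hdisj (v := v)
  rcases eq_zero_or_top_or_mem hUD hv with rfl | rfl | h | h
  · simp [pos_zero]
  · rw [pos_top]; omega
  · have := hb.1 h; omega
  · exact (hb.2 h).2

theorem pos_lt_pos_of_mem_up (hUD : D ∪ U = Finset.Icc 1 (n + 1)) (hdisj : Disjoint D U)
    {a b : ℕ} (hab : a < b) (hb : b ≤ n + 2) (ha : a ∈ U) : pos n D U b < pos n D U a := by
  have h1 := (pos_bounds hUD hdisj (v := a)).2 ha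
  have h2 := pos_bounds hUD hdisj (v := b)
  rcases eq_zero_or_top_or_mem hUD hb with rfl | rfl | h | h
  · omega
  · rw [pos_top]; omega
  · have := h2.1 h; omega
  · rw [pos_of_mem_up hUD hdisj h, pos_of_mem_up hUD hdisj ha]
    refine Nat.add_lt_add_left (Finset.card_lt_card ?_) _
    rw [Finset.ssubset_iff_of_subset fun u hu => ?_]
    · exact ⟨b, by simp [h, hab], by simp⟩
    · rw [Finset.mem_filter] at *
      exact ⟨hu.1, hab.trans hu.2⟩

theorem pos_lt_pos_of_notMem_up (hUD : D ∪ U = Finset.Icc 1 (n + 1)) (hdisj : Disjoint D U)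
    {a b : ℕ} (hab : a < b) (hb : b ≤ n + 2) (ha : a ∉ U) : pos n D U a < pos n D U b := by
  have h1 := pos_bounds hUD hdisj (v := a)
  have h2 := pos_bounds hUD hdisj (v := b)
  have ha' : a = 0 ∨ a ∈ D := by
    rcases eq_zero_or_top_or_mem hUD (hab.le.trans hb) with h | h | h | h
    · exact Or.inl h
    · omega
    · exact Or.inr h
    · exact absurd h ha
  have ha'' : pos n D U a ≤ D.card ∧ (a = 0 → pos n D U a = 0) := by
    refine ⟨?_, by rintro rfl; exact pos_zero⟩
    rcases ha' with rfl | h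
    · simp [pos_zero]
    · exact (h1.1 h).2
  rcases eq_zero_or_top_or_mem hUD hb with rfl | rfl | h | h
  · omega
  · rw [pos_top]; omega
  · rcases ha' with rfl | haD
    · have := h2.1 h; omega
    · rw [pos_of_mem_down hUD h, pos_of_mem_down hUD haD]
      refine Nat.add_lt_add_left (Finset.card_lt_card ?_) _
      rw [Finset.ssubset_iff_of_subset fun u hu => ?_]
      · exact ⟨a, by simp [haD, hab], by simp⟩
      · rw [Finset.mem_filter] at *
        exact ⟨hu.1, hu.2.trans hab⟩
  · have := h2.2 h; omega

theorem pos_inj (hUD : D ∪ U = Finset.Icc 1 (n + 1)) (hdisj : Disjoint D U) {a b : ℕ}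
    (ha : a ≤ n + 2) (hb : b ≤ n + 2) : pos n D U a = pos n D U b ↔ a = b := by
  refine ⟨fun h => ?_, fun h => h ▸ rfl⟩
  rcases lt_trichotomy a b with hab | hab | hab
  · by_cases haU : a ∈ U
    · have := pos_lt_pos_of_mem_up hUD hdisj hab hb haU; omega
    · have := pos_lt_pos_of_notMem_up hUD hdisj hab hb haU; omega
  · exact hab
  · by_cases hbU : b ∈ U
    · have := pos_lt_pos_of_mem_up hUD hdisj hab ha hbU; omega
    · have := pos_lt_pos_of_notMem_up hUD hdisj hab ha hbU; omega

theorem relpos_spec (hUD : D ∪ U = Finset.Icc 1 (n + 1)) (hdisj : Disjoint D U) {a v : ℕ}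
    (ha : a ≤ n + 2) (hv : v ≤ n + 2) :
    (pos n D U a ≤ pos n D U v ∧ relpos n D U a v + pos n D U a = pos n D U v) ∨
      (pos n D U v < pos n D U a ∧
        relpos n D U a v + pos n D U a = pos n D U v + (n + 3)) := by
  have h1 := pos_le hUD hdisj ha
  have h2 := pos_le hUD hdisj hv
  rw [relpos]
  by_cases h : pos n D U a ≤ pos n D U v
  · left
    rw [Nat.mod_eq_sub_mod (by omega), Nat.mod_eq_of_lt (by omega)]
    omega
  · right
    rw [Nat.mod_eq_of_lt (by omega)]
    omega

theorem relpos_le (a v : ℕ) : relpos n D U a v ≤ n + 2 :=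
  Nat.le_of_lt_succ (Nat.mod_lt _ (by omega))

theorem relpos_inj (hUD : D ∪ U = Finset.Icc 1 (n + 1)) (hdisj : Disjoint D U) {j a b : ℕ}
    (hj : j ≤ n + 2) (ha : a ≤ n + 2) (hb : b ≤ n + 2) :
    relpos n D U j a = relpos n D U j b ↔ a = b := by
  have h1 := relpos_spec hUD hdisj hj ha
  have h2 := relpos_spec hUD hdisj hj hb
  have h3 := pos_le hUD hdisj ha
  have h4 := pos_le hUD hdisj hb
  have h5 := pos_inj hUD hdisj ha hb
  rw [← h5]
  omega

theorem relpos_self (a : ℕ) : relpos n D U a a = 0 := by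
  simp [relpos]

/-- The cyclic distance can be computed after rotating the polygon so that `j` comes first. -/
theorem relpos_rotate (hUD : D ∪ U = Finset.Icc 1 (n + 1)) (hdisj : Disjoint D U) {j a v : ℕ}
    (hj : j ≤ n + 2) (ha : a ≤ n + 2) (hv : v ≤ n + 2) :
    (relpos n D U j a ≤ relpos n D U j v ∧
        relpos n D U a v + relpos n D U j a = relpos n D U j v) ∨
      (relpos n D U j v < relpos n D U j a ∧
        relpos n D U a v + relpos n D U j a = relpos n D U j v + (n + 3)) := by
  have h1 := relpos_spec hUD hdisj hj ha
  have h2 := relpos_spec hUD hdisj hj hv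
  have h3 := relpos_spec hUD hdisj ha hv
  have h4 := pos_le hUD hdisj ha
  have h5 := pos_le hUD hdisj hv
  have h6 := pos_le hUD hdisj hj
  omega

theorem image_relpos (hUD : D ∪ U = Finset.Icc 1 (n + 1)) (hdisj : Disjoint D U) {j : ℕ}
    (hj : j ≤ n + 2) :
    (Finset.range (n + 3)).image (relpos n D U j) = Finset.range (n + 3) := by
  refine Finset.eq_of_subset_of_card_le (fun v hv => ?_) ?_
  · obtain ⟨a, -, rfl⟩ := Finset.mem_image.1 hv
    exact Finset.mem_range.2 (Nat.lt_succ_of_le (relpos_le j a))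
  · rw [Finset.card_image_of_injOn]
    intro a ha b hb h
    simp only [Finset.coe_range, Set.mem_Iio] at ha hb
    exact (relpos_inj hUD hdisj hj (by omega) (by omega)).1 h

theorem exists_relpos_eq (hUD : D ∪ U = Finset.Icc 1 (n + 1)) (hdisj : Disjoint D U) {j : ℕ}
    (hj : j ≤ n + 2) {a : ℕ} (ha : a ≤ n + 2) : ∃ v ≤ n + 2, relpos n D U j v = a := by
  have h : a ∈ (Finset.range (n + 3)).image (relpos n D U j) := by
    rw [image_relpos hUD hdisj hj, Finset.mem_range]; omega
  obtain ⟨v, hv, rfl⟩ := Finset.mem_image.1 h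
  exact ⟨v, Nat.le_of_lt_succ (Finset.mem_range.1 hv), rfl⟩

theorem card_strictBetween (hUD : D ∪ U = Finset.Icc 1 (n + 1)) (hdisj : Disjoint D U) {a b : ℕ}
    (ha : a ≤ n + 2) :
    ((Finset.range (n + 3)).filter fun v => StrictBetween n D U a b v).card =
      relpos n D U a b - 1 := by
  have himg : ((Finset.range (n + 3)).filter fun v => StrictBetween n D U a b v).image
      (relpos n D U a) = Finset.Ioo 0 (relpos n D U a b) := by
    ext c
    simp only [Finset.mem_image, Finset.mem_filter, Finset.mem_range, Finset.mem_Ioo]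
    simp only [StrictBetween]
    constructor
    · rintro ⟨v, hv, rfl⟩
      exact hv.2.2
    · intro hc
      have := relpos_le (n := n) (D := D) (U := U) a b
      obtain ⟨v, hv, rfl⟩ := exists_relpos_eq hUD hdisj ha (a := c) (by omega)
      exact ⟨v, ⟨by omega, hv, hc⟩, rfl⟩
  rw [← Finset.card_image_of_injOn (f := relpos n D U a), himg, Nat.card_Ioo, Nat.sub_zero]
  intro v hv w hw h
  rw [Finset.mem_coe, Finset.mem_filter] at hv hw
  exact (relpos_inj hUD hdisj ha hv.2.1 hw.2.1).1 h

theorem strictBetween_ends (hUD : D ∪ U = Finset.Icc 1 (n + 1)) (hdisj : Disjoint D U) {a b : ℕ}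
    (hab : a < b) (hb : b ≤ n + 2) :
    (StrictBetween n D U a b 0 ↔ a ∈ U) ∧ (StrictBetween n D U a b (n + 2) ↔ b ∈ U) := by
  have ha : a ≤ n + 2 := hab.le.trans hb
  have hUtop : n + 2 ∉ U := fun h => by
    have := (mem_or_mem_iff hUD _).1 (Or.inr h); omega
  have hU0 : 0 ∉ U := fun h => by
    have := (mem_or_mem_iff hUD _).1 (Or.inr h); omega
  have htop : ∀ v ≤ n + 2, (v ∈ U ↔ pos n D U (n + 2) < pos n D U v) := by
    intro v hv
    rcases hv.lt_or_eq with hv | rfl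
    · by_cases h : v ∈ U
      · simp [h, pos_lt_pos_of_mem_up hUD hdisj hv le_rfl h]
      · have := pos_lt_pos_of_notMem_up hUD hdisj hv le_rfl h
        simp only [h, false_iff]; omega
    · simp [hUtop]
  have hlt : (pos n D U (n + 2) < pos n D U a ∧ pos n D U b < pos n D U a) ∨
      (pos n D U a ≤ pos n D U (n + 2) ∧ pos n D U a < pos n D U b) := by
    rw [← not_lt, ← htop a ha]
    by_cases h : a ∈ U
    · exact Or.inl ⟨h, pos_lt_pos_of_mem_up hUD hdisj hab hb h⟩
    · exact Or.inr ⟨h, pos_lt_pos_of_notMem_up hUD hdisj hab hb h⟩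
  have hab' := relpos_spec hUD hdisj ha hb
  have ha0 := relpos_spec hUD hdisj ha (Nat.zero_le (n + 2))
  have hat := relpos_spec hUD hdisj ha (le_refl (n + 2))
  have hp0 : pos n D U 0 < pos n D U b :=
    pos_lt_pos_of_notMem_up hUD hdisj (by omega) hb hU0
  have hpa := pos_le hUD hdisj ha
  have hpb := pos_le hUD hdisj hb
  have hpt := pos_le hUD hdisj (le_refl (n + 2))
  have hz : pos n D U 0 = 0 := pos_zero
  have hne : pos n D U a ≠ pos n D U (n + 2) := fun h => by
    have := (pos_inj hUD hdisj ha le_rfl).1 h; omega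
  rw [htop a ha, htop b hb]
  simp only [StrictBetween]
  constructor <;> constructor <;> intro h <;> omega

theorem bel_add_one (hUD : D ∪ U = Finset.Icc 1 (n + 1)) (hdisj : Disjoint D U) {a b : ℕ}
    (hab : a < b) (hb : b ≤ n + 2) : bel n D U (a, b) + 1 = relpos n D U a b := by
  have ha : a ≤ n + 2 := hab.le.trans hb
  have hpos : 0 < relpos n D U a b := by
    have h1 := relpos_inj hUD hdisj ha ha hb
    rw [relpos_self] at h1
    omega
  obtain ⟨hS0, hSt⟩ := strictBetween_ends hUD hdisj hab hb
  have hSa : ¬ StrictBetween n D U a b a := by simp [StrictBetween, relpos_self]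
  have hSb : ¬ StrictBetween n D U a b b := by simp [StrictBetween]
  have hcard := card_strictBetween hUD hdisj (b := b) ha
  obtain ⟨S, hS, hSc⟩ : ∃ S : Finset ℕ, (∀ v, v ∈ S ↔ v < n + 3 ∧ StrictBetween n D U a b v) ∧
      S.card = relpos n D U a b - 1 :=
    ⟨_, fun v => by rw [Finset.mem_filter, Finset.mem_range], hcard⟩
  have hsplit := Finset.card_filter_add_card_filter_not (s := S) (fun v => v = 0 ∨ v = n + 2)
  have hends : (S.filter fun v => v = 0 ∨ v = n + 2).card =
      (({a, b} : Finset ℕ).filter fun v => v ∈ U).card := by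
    have e : S.filter (fun v => v = 0 ∨ v = n + 2) =
        ({0, n + 2} : Finset ℕ).filter fun v => StrictBetween n D U a b v := by
      ext v
      rw [Finset.mem_filter, Finset.mem_filter, hS, Finset.mem_insert, Finset.mem_singleton]
      constructor
      · rintro ⟨h, h'⟩
        exact ⟨h', h.2⟩
      · rintro ⟨h, h'⟩
        exact ⟨⟨by omega, h'⟩, h⟩
    rw [e]
    by_cases h1 : a ∈ U <;> by_cases h2 : b ∈ U <;>
      simp [Finset.filter_insert, Finset.filter_singleton, hS0, hSt, h1, h2, hab.ne]
  have hBel : Bel n D U (a, b) =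
      S.filter (fun v => ¬ (v = 0 ∨ v = n + 2)) ∪ ({a, b} : Finset ℕ).filter (fun v => v ∈ U) := by
    ext v
    rw [Bel, Finset.mem_union, Finset.mem_filter, Finset.mem_filter, Finset.mem_filter, hS,
      Finset.mem_insert, Finset.mem_singleton, Finset.mem_Icc]
    have hvU : v ∈ U → 1 ≤ v ∧ v ≤ n + 1 := fun h => (mem_or_mem_iff hUD v).1 (Or.inr h)
    constructor
    · rintro ⟨h, h' | h'⟩
      · exact Or.inl ⟨⟨by omega, h'⟩, by omega⟩
      · exact Or.inr h'.symm
    · rintro (⟨⟨h1, h2⟩, h⟩ | h)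
      · exact ⟨by omega, Or.inl h2⟩
      · exact ⟨hvU h.2, Or.inr h.symm⟩
  have hdis : Disjoint (S.filter (fun v => ¬ (v = 0 ∨ v = n + 2)))
      (({a, b} : Finset ℕ).filter (fun v => v ∈ U)) := by
    rw [Finset.disjoint_left]
    intro v hv hv'
    rw [Finset.mem_filter, hS] at hv
    rw [Finset.mem_filter, Finset.mem_insert, Finset.mem_singleton] at hv'
    rcases hv'.1 with rfl | rfl
    · exact hSa hv.1.2
    · exact hSb hv.1.2
  rw [hends, hSc, add_comm] at hsplit
  rw [bel, hBel, Finset.card_union_of_disjoint hdis]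
  rw [hsplit, Nat.sub_add_cancel hpos]

/-- The chord `e` after rotating the polygon so that `j` becomes the vertex `0`. -/
def rotate (n : ℕ) (D U : Finset ℕ) (j : ℕ) (e : ℕ × ℕ) : ℕ × ℕ :=
  (min (relpos n D U j e.1) (relpos n D U j e.2), max (relpos n D U j e.1) (relpos n D U j e.2))

theorem mem_chords_range {e : ℕ × ℕ} : e ∈ chords (Finset.range (n + 3)) ↔ IsDiag n e := by
  rw [mem_chords, Finset.mem_range, Finset.mem_range, IsDiag]
  omega

theorem rotate_injOn (hUD : D ∪ U = Finset.Icc 1 (n + 1)) (hdisj : Disjoint D U) {j : ℕ}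
    (hj : j ≤ n + 2) :
    Set.InjOn (rotate n D U j) (chords (Finset.range (n + 3)) : Set (ℕ × ℕ)) := by
  rintro ⟨a, b⟩ hab ⟨c, d⟩ hcd h
  rw [Finset.mem_coe, mem_chords_range] at hab hcd
  simp only [IsDiag] at hab hcd
  simp only [rotate, Prod.mk.injEq] at h ⊢
  have h1 := relpos_inj hUD hdisj hj (show a ≤ n + 2 by omega) (show c ≤ n + 2 by omega)
  have h2 := relpos_inj hUD hdisj hj (show a ≤ n + 2 by omega) (show d ≤ n + 2 by omega)
  have h3 := relpos_inj hUD hdisj hj (show b ≤ n + 2 by omega) (show c ≤ n + 2 by omega)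
  have h4 := relpos_inj hUD hdisj hj (show b ≤ n + 2 by omega) (show d ≤ n + 2 by omega)
  omega

theorem image_rotate (hUD : D ∪ U = Finset.Icc 1 (n + 1)) (hdisj : Disjoint D U) {j : ℕ}
    (hj : j ≤ n + 2) :
    (chords (Finset.range (n + 3))).image (rotate n D U j) = chords (Finset.range (n + 3)) := by
  refine Finset.eq_of_subset_of_card_le (fun e he => ?_) ?_
  · obtain ⟨⟨a, b⟩, hab, rfl⟩ := Finset.mem_image.1 he
    rw [mem_chords_range] at hab ⊢
    simp only [IsDiag, rotate] at hab ⊢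
    have h1 := relpos_inj hUD hdisj hj (show a ≤ n + 2 by omega) (show b ≤ n + 2 by omega)
    have h2 := relpos_le (n := n) (D := D) (U := U) j a
    have h3 := relpos_le (n := n) (D := D) (U := U) j b
    omega
  · rw [Finset.card_image_of_injOn (rotate_injOn hUD hdisj hj)]

theorem cross_iff_rotate (hUD : D ∪ U = Finset.Icc 1 (n + 1)) (hdisj : Disjoint D U) {j : ℕ}
    (hj : j ≤ n + 2) {e f : ℕ × ℕ} (he : IsDiag n e) (hf : IsDiag n f) :
    Cross n D U e f ↔ LinCross (rotate n D U j e) (rotate n D U j f) := by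
  obtain ⟨a, b⟩ := e
  obtain ⟨c, d⟩ := f
  simp only [IsDiag] at he hf
  have ha : a ≤ n + 2 := by omega
  have hb : b ≤ n + 2 := by omega
  have hc : c ≤ n + 2 := by omega
  have hd : d ≤ n + 2 := by omega
  have iab := relpos_inj hUD hdisj hj ha hb
  have iac := relpos_inj hUD hdisj hj ha hc
  have iad := relpos_inj hUD hdisj hj ha hd
  have ibc := relpos_inj hUD hdisj hj hb hc
  have ibd := relpos_inj hUD hdisj hj hb hd
  have icd := relpos_inj hUD hdisj hj hc hd
  have rab := relpos_rotate hUD hdisj hj ha hb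
  have rba := relpos_rotate hUD hdisj hj hb ha
  have rac := relpos_rotate hUD hdisj hj ha hc
  have rad := relpos_rotate hUD hdisj hj ha hd
  have rbc := relpos_rotate hUD hdisj hj hb hc
  have rbd := relpos_rotate hUD hdisj hj hb hd
  have la := relpos_le (n := n) (D := D) (U := U) j a
  have lb := relpos_le (n := n) (D := D) (U := U) j b
  have lc := relpos_le (n := n) (D := D) (U := U) j c
  have ld := relpos_le (n := n) (D := D) (U := U) j d
  simp only [Cross, StrictBetween, LinCross, rotate, ne_eq, hc, hd, true_and,
    ← iab, ← iac, ← iad, ← ibc, ← ibd, ← icd]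
  have hne : relpos n D U j a ≠ relpos n D U j b := fun h => by
    have := iab.1 h; omega
  have hne' : relpos n D U j c ≠ relpos n D U j d := fun h => by
    have := icd.1 h; omega
  clear iab iac iad ibc ibd icd
  generalize relpos n D U j a = xa at *
  generalize relpos n D U j b = xb at *
  generalize relpos n D U j c = xc at *
  generalize relpos n D U j d = xd at *
  rcases hne.lt_or_gt with h | h <;> rcases hne'.lt_or_gt with h' | h' <;>
    simp only [min_eq_left h.le, min_eq_right h.le, max_eq_left h.le, max_eq_right h.le,
      min_eq_left h'.le, min_eq_right h'.le, max_eq_left h'.le, max_eq_right h'.le] <;>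
    constructor <;> intro H <;> omega

theorem LinCross.symm {e f : ℕ × ℕ} (h : LinCross e f) : LinCross f e := Or.symm h

theorem cross_comm (hUD : D ∪ U = Finset.Icc 1 (n + 1)) (hdisj : Disjoint D U)
    {e f : ℕ × ℕ} (he : IsDiag n e) (hf : IsDiag n f) : Cross n D U e f ↔ Cross n D U f e := by
  rw [cross_iff_rotate hUD hdisj (Nat.zero_le _) he hf,
    cross_iff_rotate hUD hdisj (Nat.zero_le _) hf he]
  exact ⟨LinCross.symm, LinCross.symm⟩

theorem not_cross_of_isBoundaryEdge {e f : ℕ × ℕ} (he : IsBoundaryEdge n D U e) :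
    ¬ Cross n D U e f := by
  rintro ⟨-, -, -, -, -, -, h⟩
  have h' := he.2
  simp only [StrictBetween] at h
  omega

/-- The boundary edges of the polygon. -/
def boundaryEdges (n : ℕ) (D U : Finset ℕ) : Finset (ℕ × ℕ) :=
  (chords (Finset.range (n + 3))).filter fun e => IsBoundaryEdge n D U e

theorem mem_boundaryEdges {e : ℕ × ℕ} : e ∈ boundaryEdges n D U ↔ IsBoundaryEdge n D U e := by
  rw [boundaryEdges, Finset.mem_filter, mem_chords_range, and_iff_right_iff_imp]
  exact And.left

theorem mem_allTri {T : Finset (ℕ × ℕ)} : T ∈ allTri n D U ↔ IsTriangulation n D U T := by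
  rw [allTri, Finset.mem_filter, Finset.mem_powerset, and_iff_right_iff_imp]
  intro h e he
  have := h.1 e he
  have hd := this.1
  rw [IsDiag] at hd
  rw [Finset.mem_filter, Finset.mem_product, Finset.mem_range, Finset.mem_range]
  exact ⟨by omega, this⟩

theorem union_boundaryEdges_mem (hUD : D ∪ U = Finset.Icc 1 (n + 1)) (hdisj : Disjoint D U)
    {T : Finset (ℕ × ℕ)} (hT : IsTriangulation n D U T) :
    T ∪ boundaryEdges n D U ∈ maxIndep (chords (Finset.range (n + 3))) (Cross n D U) := by
  obtain ⟨h1, h2, h3⟩ := hT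
  rw [mem_maxIndep]
  intro e
  rw [mem_chords_range, Finset.mem_union, mem_boundaryEdges]
  constructor
  · rintro (he | he)
    · refine ⟨(h1 e he).1, fun f hf => ?_⟩
      rw [Finset.mem_union, mem_boundaryEdges] at hf
      rcases hf with hf | hf
      · exact h2 e he f hf
      · rw [cross_comm hUD hdisj (h1 e he).1 hf.1]
        exact not_cross_of_isBoundaryEdge hf
    · exact ⟨he.1, fun f _ => not_cross_of_isBoundaryEdge he⟩
  · rintro ⟨he, hX⟩
    by_contra! hne
    obtain ⟨f, hf, hef⟩ := h3 e ⟨he, hne.2⟩ hne.1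
    exact hX f (Finset.mem_union_left _ hf) hef

theorem sum_allTri {M : Type*} [AddCommMonoid M] (hUD : D ∪ U = Finset.Icc 1 (n + 1))
    (hdisj : Disjoint D U) (w : Finset (ℕ × ℕ) → M) :
    ∑ T ∈ allTri n D U, w (T ∪ boundaryEdges n D U) =
      ∑ S ∈ maxIndep (chords (Finset.range (n + 3))) (Cross n D U), w S := by
  refine Finset.sum_nbij' (fun T => T ∪ boundaryEdges n D U)
    (fun S => S \ boundaryEdges n D U) ?_ ?_ ?_ ?_ ?_
  · exact fun T hT => union_boundaryEdges_mem hUD hdisj (mem_allTri.1 hT)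
  · intro S hS
    rw [mem_maxIndep] at hS
    rw [mem_allTri]
    refine ⟨fun e he => ?_, fun e he f hf => ?_, fun e he heS => ?_⟩
    · rw [Finset.mem_sdiff, mem_boundaryEdges] at he
      exact ⟨mem_chords_range.1 ((hS e).1 he.1).1, he.2⟩
    · exact ((hS e).1 (Finset.mem_sdiff.1 he).1).2 f (Finset.mem_sdiff.1 hf).1
    · have heS' : e ∉ S := fun h =>
        heS (Finset.mem_sdiff.2 ⟨h, fun h' => he.2 (mem_boundaryEdges.1 h')⟩)
      rw [hS, mem_chords_range, not_and] at heS'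
      have := heS' he.1
      push Not at this
      obtain ⟨f, hf, hef⟩ := this
      refine ⟨f, Finset.mem_sdiff.2 ⟨hf, fun h => ?_⟩, hef⟩
      rw [mem_boundaryEdges] at h
      rw [cross_comm hUD hdisj he.1 h.1] at hef
      exact not_cross_of_isBoundaryEdge h hef
  · intro T hT
    refine Finset.union_sdiff_cancel_right (Finset.disjoint_left.2 fun e he h => ?_)
    exact ((mem_allTri.1 hT).1 e he).2 (mem_boundaryEdges.1 h)
  · intro S hS
    rw [mem_maxIndep] at hS
    refine Finset.sdiff_union_of_subset fun e he => ?_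
    rw [mem_boundaryEdges] at he
    exact (hS e).2 ⟨mem_chords_range.2 he.1, fun f _ => not_cross_of_isBoundaryEdge he⟩
  · exact fun _ _ => rfl

/-- The triangulation `T` together with the boundary edges, rotated so that `j` becomes `0`. -/
def rotateTri (n : ℕ) (D U : Finset ℕ) (j : ℕ) (T : Finset (ℕ × ℕ)) : Finset (ℕ × ℕ) :=
  (T ∪ boundaryEdges n D U).image (rotate n D U j)

theorem cross_rotate_chords (hUD : D ∪ U = Finset.Icc 1 (n + 1)) (hdisj : Disjoint D U) {j : ℕ}
    (hj : j ≤ n + 2) : ∀ e ∈ chords (Finset.range (n + 3)), ∀ f ∈ chords (Finset.range (n + 3)),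
      (Cross n D U e f ↔ LinCross (rotate n D U j e) (rotate n D U j f)) :=
  fun _ he _ hf =>
    cross_iff_rotate hUD hdisj hj (mem_chords_range.1 he) (mem_chords_range.1 hf)

theorem sum_rotateTri {M : Type*} [AddCommMonoid M] (hUD : D ∪ U = Finset.Icc 1 (n + 1))
    (hdisj : Disjoint D U) {j : ℕ} (hj : j ≤ n + 2) (w : Finset (ℕ × ℕ) → M) :
    ∑ T ∈ allTri n D U, w (rotateTri n D U j T) =
      ∑ S ∈ fullTri (Finset.range (n + 3)), w S := by
  have h := sum_maxIndep_image (rotate n D U j) (rotate_injOn hUD hdisj hj)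
    (cross_rotate_chords hUD hdisj hj) w
  rw [image_rotate hUD hdisj hj] at h
  rw [fullTri, ← h]
  exact sum_allTri hUD hdisj fun S => w (S.image (rotate n D U j))

theorem rotateTri_mem (hUD : D ∪ U = Finset.Icc 1 (n + 1)) (hdisj : Disjoint D U) {j : ℕ}
    (hj : j ≤ n + 2) {T : Finset (ℕ × ℕ)} (hT : T ∈ allTri n D U) :
    rotateTri n D U j T ∈ fullTri (Finset.range (n + 3)) := by
  have h := union_boundaryEdges_mem hUD hdisj (mem_allTri.1 hT)
  have h' := (image_mem_maxIndep_iff (rotate_injOn hUD hdisj hj)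
    (cross_rotate_chords hUD hdisj hj) (subset_of_mem_maxIndep h)).2 h
  rwa [image_rotate hUD hdisj hj] at h'

theorem edgeOf_iff_rotate (hUD : D ∪ U = Finset.Icc 1 (n + 1)) (hdisj : Disjoint D U) {j : ℕ}
    (hj : j ≤ n + 2) {T : Finset (ℕ × ℕ)} (hT : T ∈ allTri n D U) {a b : ℕ} (hab : a < b)
    (hb : b ≤ n + 2) :
    EdgeOf n D U T a b ↔ rotate n D U j (a, b) ∈ rotateTri n D U j T := by
  have hsub := subset_of_mem_maxIndep (union_boundaryEdges_mem hUD hdisj (mem_allTri.1 hT))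
  rw [EdgeOf, ← mem_boundaryEdges, ← Finset.mem_union, rotateTri, Finset.mem_image]
  constructor
  · exact fun h => ⟨_, h, rfl⟩
  · rintro ⟨e, he, h⟩
    rwa [← rotate_injOn hUD hdisj hj (hsub he) (mem_chords_range.2 ⟨hab, hb⟩) h]

theorem isTriangleOf_iff_rootTriangle (hUD : D ∪ U = Finset.Icc 1 (n + 1)) (hdisj : Disjoint D U)
    {T : Finset (ℕ × ℕ)} (hT : T ∈ allTri n D U) {i j k : ℕ} (hij : i < j) (hjk : j < k)
    (hk : k ≤ n + 2) :
    IsTriangleOf n D U T i j k ↔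
      RootTriangle (rotateTri n D U j T)
        (min (relpos n D U j i) (relpos n D U j k))
        (max (relpos n D U j i) (relpos n D U j k)) := by
  have hj : j ≤ n + 2 := by omega
  rw [IsTriangleOf, edgeOf_iff_rotate hUD hdisj hj hT hij hj,
    edgeOf_iff_rotate hUD hdisj hj hT hjk hk,
    edgeOf_iff_rotate hUD hdisj hj hT (hij.trans hjk) hk, RootTriangle]
  simp only [rotate, relpos_self, Nat.zero_le, min_eq_left, min_eq_right, max_eq_left,
    max_eq_right, hij, hjk, hk, true_and]
  rcases le_total (relpos n D U j i) (relpos n D U j k) with h | h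
  · simp only [min_eq_left h, max_eq_right h]
    tauto
  · simp only [min_eq_right h, max_eq_left h]
    tauto

/-- After rotating to a down vertex, the larger labels precede the smaller ones; after rotating
to an up vertex, they follow them. -/
theorem relpos_lt_relpos (hUD : D ∪ U = Finset.Icc 1 (n + 1)) (hdisj : Disjoint D U) {i j k : ℕ}
    (hij : i < j) (hjk : j < k) (hk : k ≤ n + 2) :
    (j ∉ U → relpos n D U j k < relpos n D U j i) ∧
      (j ∈ U → relpos n D U j i < relpos n D U j k) := by
  have hj : j ≤ n + 2 := by omega
  have hi : i ≤ n + 2 := by omega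
  have r1 := relpos_spec hUD hdisj hj hi
  have r2 := relpos_spec hUD hdisj hj hk
  have p1 := pos_le hUD hdisj hi
  have p2 := pos_le hUD hdisj hj
  have p3 := pos_le hUD hdisj hk
  have hi' : (pos n D U j < pos n D U i ∧ pos n D U k < pos n D U i) ∨
      (pos n D U i < pos n D U j ∧ pos n D U i < pos n D U k) := by
    by_cases hiU : i ∈ U
    · exact Or.inl ⟨pos_lt_pos_of_mem_up hUD hdisj hij hj hiU,
        pos_lt_pos_of_mem_up hUD hdisj (hij.trans hjk) hk hiU⟩
    · exact Or.inr ⟨pos_lt_pos_of_notMem_up hUD hdisj hij hj hiU,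
        pos_lt_pos_of_notMem_up hUD hdisj (hij.trans hjk) hk hiU⟩
  constructor <;> intro hjU
  · have := pos_lt_pos_of_notMem_up hUD hdisj hjk hk hjU
    omega
  · have := pos_lt_pos_of_mem_up hUD hdisj hjk hk hjU
    omega

theorem relpos_pos (hUD : D ∪ U = Finset.Icc 1 (n + 1)) (hdisj : Disjoint D U) {a b : ℕ}
    (ha : a ≤ n + 2) (hb : b ≤ n + 2) (hab : a ≠ b) : 0 < relpos n D U a b := by
  have h := relpos_inj hUD hdisj ha ha hb
  rw [relpos_self] at h
  omega

theorem relpos_add_relpos (hUD : D ∪ U = Finset.Icc 1 (n + 1)) (hdisj : Disjoint D U) {a b : ℕ}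
    (ha : a ≤ n + 2) (hb : b ≤ n + 2) (hab : a ≠ b) :
    relpos n D U a b + relpos n D U b a = n + 3 := by
  have h1 := relpos_spec hUD hdisj ha hb
  have h2 := relpos_spec hUD hdisj hb ha
  have h3 := pos_inj hUD hdisj ha hb
  omega

theorem exists_threshold {S : Finset ℕ} {p : ℕ → Prop} {x : ℕ → ℕ} {d : ℕ}
    (hp : ∃ v ∈ S, p v) (hnp : ∃ v ∈ S, ¬ p v) (hx : ∀ v ∈ S, 1 ≤ x v ∧ x v ≤ d)
    (hlt : ∀ v ∈ S, ∀ w ∈ S, p v → ¬ p w → x v < x w) :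
    ∃ t, 1 ≤ t ∧ t < d ∧ ∀ v ∈ S, (p v ↔ x v ≤ t) := by
  obtain ⟨v₀, hv₀, hpv₀⟩ := hp
  obtain ⟨w₀, hw₀, hpw₀⟩ := hnp
  obtain ⟨v, hv, hmax⟩ := Finset.exists_max_image (S.filter p) x
    ⟨v₀, Finset.mem_filter.2 ⟨hv₀, hpv₀⟩⟩
  rw [Finset.mem_filter] at hv
  refine ⟨x v, (hx v hv.1).1, (hlt v hv.1 w₀ hw₀ hv.2 hpw₀).trans_le (hx w₀ hw₀).2,
    fun w hw => ⟨fun h => hmax w (Finset.mem_filter.2 ⟨hw, h⟩), fun h => ?_⟩⟩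
  by_contra hpw
  exact absurd h (not_le.2 (hlt v hv.1 w hw hv.2 hpw))

set_option maxHeartbeats 1000000 in
/-- Every label is the middle vertex of some triangle, and its coordinate is governed by the
triangle at the root of the rotated triangulation. -/
theorem exists_xcoord_eq (hUD : D ∪ U = Finset.Icc 1 (n + 1)) (hdisj : Disjoint D U) {j : ℕ}
    (hj : j ∈ Finset.Icc 1 (n + 1)) :
    ∃ t, 1 ≤ t ∧ t < n + 2 ∧ ∀ T ∈ allTri n D U,
      xcoord n D U T j =
        if j ∈ D then
          (switchWeight (n + 2) t (fun a b => a * (n + 2 + 1 - b)) (rotateTri n D U j T) : ℝ)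
        else (n : ℝ) + 2 -
          (switchWeight (n + 2) t (fun a b => a * (n + 2 + 1 - b)) (rotateTri n D U j T) : ℝ) := by
  rw [Finset.mem_Icc] at hj
  have hj' : j ≤ n + 2 := by omega
  have hjDU : j ∈ D ↔ j ∉ U := by
    have h := (mem_or_mem_iff hUD j).2 hj
    have h' : j ∈ D → j ∉ U := fun h => Finset.disjoint_left.1 hdisj h
    tauto
  have hne : ∀ v ∈ (Finset.range (n + 3)).erase j, v ≠ j ∧ v ≤ n + 2 := by
    intro v hv
    rw [Finset.mem_erase, Finset.mem_range] at hv
    exact ⟨hv.1, by omega⟩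
  obtain ⟨t, ht1, ht2, ht⟩ := exists_threshold (S := (Finset.range (n + 3)).erase j)
    (p := fun v => v < j ↔ j ∈ U) (x := relpos n D U j) (d := n + 2)
    (by
      by_cases h : j ∈ U
      · exact ⟨0, by simp; omega, by simp [h]; omega⟩
      · exact ⟨n + 2, by simp; omega, by simp [h]; omega⟩)
    (by
      by_cases h : j ∈ U
      · exact ⟨n + 2, by simp; omega, by simp [h]; omega⟩
      · exact ⟨0, by simp; omega, by simp [h]; omega⟩)
    (fun v hv => ⟨relpos_pos hUD hdisj hj' (hne v hv).2 (hne v hv).1.symm, relpos_le j v⟩)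
    (by
      intro v hv w hw hpv hpw
      have hv' := hne v hv
      have hw' := hne w hw
      by_cases h : j ∈ U
      · simp only [h, iff_true] at hpv hpw
        exact (relpos_lt_relpos hUD hdisj hpv (by omega : j < w) hw'.2).2 h
      · simp only [h, iff_false, not_not] at hpv hpw
        exact (relpos_lt_relpos hUD hdisj hpw (by omega : j < v) hv'.2).1 h)
  have hlow : ∀ i < j, (j ∈ U ↔ relpos n D U j i ≤ t) := by
    intro i hi
    rw [← ht i (by rw [Finset.mem_erase, Finset.mem_range]; omega)]
    simp [hi]
  have hhigh : ∀ k, j < k → k ≤ n + 2 → (j ∉ U ↔ relpos n D U j k ≤ t) := by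
    intro k hk hk'
    rw [← ht k (by rw [Finset.mem_erase, Finset.mem_range]; omega)]
    simp [hk.not_gt]
  refine ⟨t, ht1, ht2, fun T hT => ?_⟩
  have hT' : rotateTri n D U j T ∈ fullTri (Finset.range (n + 2 + 1)) :=
    rotateTri_mem hUD hdisj hj' hT
  have hex : ∃ p : ℕ × ℕ, IsTriangleOf n D U T p.1 j p.2 := by
    obtain ⟨a, ha, b, hb, hab⟩ := exists_rootTriangle ht1 ht2 hT'
    rw [Finset.mem_Icc] at ha hb
    obtain ⟨u, hu, rfl⟩ := exists_relpos_eq hUD hdisj hj' (a := a) (by omega)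
    obtain ⟨v, hv, rfl⟩ := exists_relpos_eq hUD hdisj hj' (a := b) (by omega)
    have huj : u ≠ j := by rintro rfl; rw [relpos_self] at ha; omega
    have hvj : v ≠ j := by rintro rfl; rw [relpos_self] at hb; omega
    by_cases h : j ∈ U
    · have hu' : u < j := by
        by_contra hc
        exact (hhigh u (by omega) hu).2 ha.2 h
      have hv' : j < v := by
        by_contra hc
        have := (hlow v (by omega)).1 h
        omega
      refine ⟨(u, v), (isTriangleOf_iff_rootTriangle hUD hdisj hT hu' hv' hv).2 ?_⟩
      rwa [min_eq_left (by omega), max_eq_right (by omega)]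
    · have hu' : j < u := by
        by_contra hc
        exact h ((hlow u (by omega)).2 ha.2)
      have hv' : v < j := by
        by_contra hc
        have := (hhigh v (by omega) hv).1 h
        omega
      refine ⟨(v, u), (isTriangleOf_iff_rootTriangle hUD hdisj hT hv' hu' hu).2 ?_⟩
      rwa [min_eq_right (by omega), max_eq_left (by omega)]
  rw [xcoord, dif_pos hex]
  have hspec := hex.choose_spec
  generalize hex.choose = p at hspec
  obtain ⟨i, k⟩ := p
  obtain ⟨hij, hjk, hk, -⟩ := id hspec
  simp only at hij hjk hk hspec ⊢
  have hi : i ≤ n + 2 := by omega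
  rw [isTriangleOf_iff_rootTriangle hUD hdisj hT hij hjk hk] at hspec
  have hbi := bel_add_one hUD hdisj hij hj'
  have hbk := bel_add_one hUD hdisj hjk hk
  have hxi := relpos_add_relpos hUD hdisj hi hj' hij.ne
  have hpi := relpos_pos hUD hdisj hj' hi hij.ne'
  have hpk := relpos_pos hUD hdisj hj' hk hjk.ne
  have hli := relpos_le (n := n) (D := D) (U := U) j i
  have hlk := relpos_le (n := n) (D := D) (U := U) j k
  have hil := hlow i hij
  have hkh := hhigh k hjk hk
  by_cases h : j ∈ U
  · have h1 := hil.1 h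
    have h2 : ¬ relpos n D U j k ≤ t := fun h' => hkh.2 h' h
    rw [min_eq_left (by omega), max_eq_right (by omega)] at hspec
    rw [if_neg (by tauto), if_neg (by tauto), switchWeight_eq _ hT' (by rw [Finset.mem_Icc]; omega)
      (by rw [Finset.mem_Icc]; omega) hspec]
    have e1 : (relpos n D U j i : ℝ) = (n : ℝ) + 2 - bel n D U (i, j) := by
      rw [eq_sub_iff_add_eq]; norm_cast; omega
    have e2 : ((n + 2 + 1 - relpos n D U j k : ℕ) : ℝ) = (n : ℝ) + 2 - bel n D U (j, k) := by
      rw [eq_sub_iff_add_eq]; norm_cast; omega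
    rw [Nat.cast_mul, e1, e2]
  · have h1 := hkh.1 h
    have h2 : ¬ relpos n D U j i ≤ t := fun h' => h (hil.2 h')
    rw [min_eq_right (by omega), max_eq_left (by omega)] at hspec
    rw [if_pos (by tauto), if_pos (by tauto), switchWeight_eq _ hT' (by rw [Finset.mem_Icc]; omega)
      (by rw [Finset.mem_Icc]; omega) hspec]
    have e1 : (relpos n D U j k : ℝ) = bel n D U (j, k) + 1 := by
      norm_cast; omega
    have e2 : ((n + 2 + 1 - relpos n D U j i : ℕ) : ℝ) = bel n D U (i, j) + 1 := by
      norm_cast; omega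
    rw [Nat.cast_mul, e1, e2, mul_comm]

theorem card_allTri (hUD : D ∪ U = Finset.Icc 1 (n + 1)) (hdisj : Disjoint D U) :
    (allTri n D U).card = triCount (n + 2) := by
  rw [triCount, Finset.card_eq_sum_ones, Finset.card_eq_sum_ones]
  exact sum_rotateTri hUD hdisj (Nat.zero_le _) fun _ => 1

theorem two_mul_sum_xcoord (hUD : D ∪ U = Finset.Icc 1 (n + 1)) (hdisj : Disjoint D U) {j : ℕ}
    (hj : j ∈ Finset.Icc 1 (n + 1)) :
    2 * ∑ T ∈ allTri n D U, xcoord n D U T j = ((allTri n D U).card : ℝ) * ((n : ℝ) + 2) := by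
  obtain ⟨t, ht1, ht2, hx⟩ := exists_xcoord_eq hUD hdisj hj
  have hj' : j ≤ n + 2 := by rw [Finset.mem_Icc] at hj; omega
  have hsum := two_mul_sum_switchWeight ht1 ht2
  have hrot := sum_rotateTri hUD hdisj hj' fun S =>
    switchWeight (n + 2) t (fun a b => a * (n + 2 + 1 - b)) S
  rw [← hrot, ← card_allTri hUD hdisj] at hsum
  have hsum' : 2 * ∑ T ∈ allTri n D U, (switchWeight (n + 2) t (fun a b => a * (n + 2 + 1 - b))
      (rotateTri n D U j T) : ℝ) = ((n : ℝ) + 2) * (allTri n D U).card := by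
    exact_mod_cast hsum
  rw [Finset.sum_congr rfl hx]
  by_cases h : j ∈ D
  · simp only [if_pos h]
    rw [hsum', mul_comm]
  · simp only [if_neg h]
    rw [Finset.sum_sub_distrib, mul_sub, hsum', Finset.sum_const, nsmul_eq_mul]
    ring

theorem sum_perm_coordinate (n : ℕ) (i : Fin (n + 1)) :
    ∑ σ : Equiv.Perm (Fin (n + 1)), (((σ i : ℕ) : ℝ) + 1)
      = (Nat.factorial (n + 1) : ℝ) * (((n : ℝ) + 2) / 2) := by
  have hrev : ∑ σ : Equiv.Perm (Fin (n + 1)), (((σ i : ℕ) : ℝ) + 1) =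
      ∑ σ : Equiv.Perm (Fin (n + 1)), ((((Fin.rev (σ i) : Fin (n + 1)) : ℕ) : ℝ) + 1) :=
    (Equiv.sum_comp (Equiv.mulLeft (Fin.revPerm : Equiv.Perm (Fin (n + 1))))
      fun σ => (((σ i : ℕ) : ℝ) + 1)).symm
  have hadd : ∀ σ : Equiv.Perm (Fin (n + 1)),
      (((σ i : ℕ) : ℝ) + 1) + ((((Fin.rev (σ i) : Fin (n + 1)) : ℕ) : ℝ) + 1) = (n : ℝ) + 2 := by
    intro σ
    have h := (σ i).2
    norm_cast
    rw [Fin.val_rev]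
    omega
  have htwo : 2 * ∑ σ : Equiv.Perm (Fin (n + 1)), (((σ i : ℕ) : ℝ) + 1) =
      (Nat.factorial (n + 1) : ℝ) * ((n : ℝ) + 2) := by
    rw [two_mul]
    nth_rw 2 [hrev]
    rw [← Finset.sum_add_distrib, Finset.sum_congr rfl fun σ _ => hadd σ, Finset.sum_const,
      Finset.card_univ, Fintype.card_perm, Fintype.card_fin, nsmul_eq_mul]
  linarith

end Spines

namespace Spines

/-- Let `N` be the number of triangulations of `P`. Then for every
`j ∈ [n+1]`, `2·∑_T x_j(T) = N·(n+2)`; in particular the barycenter of the points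
`x(T)` has all coordinates `(n+2)/2`, which is the barycenter of the vertices of the
permutahedron (the points `(σ(1),…,σ(n+1))` for permutations `σ` of `[n+1]`). -/
theorem barycenter_of_all_triangulations (n : ℕ) (hn : 1 ≤ n) (D U : Finset ℕ)
    (hUD : D ∪ U = Finset.Icc 1 (n + 1)) (hdisj : Disjoint D U) :
    0 < (allTri n D U).card ∧
    (∀ j ∈ Finset.Icc 1 (n + 1),
      2 * ∑ T ∈ allTri n D U, xcoord n D U T j
          = ((allTri n D U).card : ℝ) * ((n : ℝ) + 2) ∧
      (∑ T ∈ allTri n D U, xcoord n D U T j) / ((allTri n D U).card : ℝ)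
          = ((n : ℝ) + 2) / 2) ∧
    (∀ i : Fin (n + 1),
      ∑ σ : Equiv.Perm (Fin (n + 1)), (((σ i : ℕ) : ℝ) + 1)
        = (Nat.factorial (n + 1) : ℝ) * (((n : ℝ) + 2) / 2)) := by
  have hpos : 0 < (allTri n D U).card := by
    rw [card_allTri hUD hdisj]
    exact triCount_pos _
  refine ⟨hpos, fun j hj => ⟨two_mul_sum_xcoord hUD hdisj hj, ?_⟩, sum_perm_coordinate n⟩
  have h := two_mul_sum_xcoord hUD hdisj hj
  have hpos' : (0 : ℝ) < (allTri n D U).card := by exact_mod_cast hpos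
  rw [div_eq_iff hpos'.ne']
  linarith

end Spines
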